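/- Let X be an n-dimensional random vector and Y an m-dimensional random vector on a common probability space. Assume that for every α ∈ ℝⁿ \ {0} and β ∈ ℝᵐ \ {0}, the two-dimensional random vector (⟨X,α⟩, ⟨Y,β⟩) has a jointly continuous, strictly positive probability density on ℝ². Then X and Y are independent if and only if for every α ∈ ℝⁿ \ {0} and β ∈ ℝᵐ \ {0} and every choice of quantile splits 0 < p₁ < q₁ < 1 and 0 < p₂ < q₂ < 1, the conditional covariance Cov_A[⟨X,α⟩, ⟨Y,β⟩] equals 0, where A is the quantile set defined for the pair (⟨X,α⟩, ⟨Y,β⟩). -/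

import Mathlib

open MeasureTheory ProbabilityTheory Set

/-- Conditional covariance of `X` and `Y` given the event `A`:
`Cov_A[X,Y] = E[X·Y | A] − E[X | A] · E[Y | A]`, where `E[· | A]` is the expectation
with respect to the conditional probability `P[|A]`. -/
noncomputable def condCov {Ω : Type*} [MeasurableSpace Ω] (P : Measure Ω) (A : Set Ω)
    (X Y : Ω → ℝ) : ℝ :=
  (∫ ω, X ω * Y ω ∂(P[|A])) - (∫ ω, X ω ∂(P[|A])) * (∫ ω, Y ω ∂(P[|A]))

/-- The cumulative distribution function of a real random variable `X` under `P`. -/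
noncomputable def cdfOf {Ω : Type*} [MeasurableSpace Ω] (P : Measure Ω) (X : Ω → ℝ) : ℝ → ℝ :=
  fun x => (P {ω | X ω ≤ x}).toReal

/-- The quantile function of `X` under `P`, i.e. the inverse of its CDF
(well defined on `(0,1)` when the CDF is a bijection onto `(0,1)`). -/
noncomputable def quantileOf {Ω : Type*} [MeasurableSpace Ω] (P : Measure Ω) (X : Ω → ℝ) : ℝ → ℝ :=
  Function.invFun (cdfOf P X)

/-- The quantile set `A = {Q_X(p₁) ≤ X ≤ Q_X(q₁)} ∩ {Q_Y(p₂) ≤ Y ≤ Q_Y(q₂)}`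
associated with the quantile splits `p₁ < q₁` and `p₂ < q₂`. -/
noncomputable def quantileSet {Ω : Type*} [MeasurableSpace Ω] (P : Measure Ω) (X Y : Ω → ℝ)
    (p₁ q₁ p₂ q₂ : ℝ) : Set Ω :=
  {ω | quantileOf P X p₁ ≤ X ω ∧ X ω ≤ quantileOf P X q₁} ∩
    {ω | quantileOf P Y p₂ ≤ Y ω ∧ Y ω ≤ quantileOf P Y q₂}

theorem mul_eq_mul_of_forall_intervalIntegral_moment_eq {u v : ℝ → ℝ}
    (hu : Continuous u) (hv : Continuous v)
    (h : ∀ a b : ℝ, a < b →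
      (∫ x in a..b, x * u x) * (∫ x in a..b, v x) = (∫ x in a..b, x * v x) * ∫ x in a..b, u x)
    (a b : ℝ) : u a * v b = u b * v a := by
  have key : ∀ a b : ℝ,
      (∫ x in a..b, x * u x) * (∫ x in a..b, v x) = (∫ x in a..b, x * v x) * ∫ x in a..b, u x := by
    intro a b
    rcases lt_trichotomy a b with hab | rfl | hab
    · exact h a b hab
    · simp
    · have := h b a hab
      simp only [intervalIntegral.integral_symm b a]
      linarith
  have hu' : Continuous fun x => x * u x := by fun_prop
  have hv' : Continuous fun x => x * v x := by fun_prop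
  have right : ∀ {w : ℝ → ℝ}, Continuous w → ∀ a b : ℝ,
      HasDerivAt (fun t => ∫ x in a..t, w x) (w b) b := fun hw a b =>
    intervalIntegral.integral_hasDerivAt_right (hw.intervalIntegrable _ _)
      (hw.stronglyMeasurableAtFilter _ _) hw.continuousAt
  have left : ∀ {w : ℝ → ℝ}, Continuous w → ∀ a b : ℝ,
      HasDerivAt (fun t => ∫ x in t..b, w x) (-w a) a := fun hw a b =>
    intervalIntegral.integral_hasDerivAt_left (hw.intervalIntegrable _ _)
      (hw.stronglyMeasurableAtFilter _ _) hw.continuousAt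
  have first : ∀ a b : ℝ,
      b * u b * (∫ x in a..b, v x) + (∫ x in a..b, x * u x) * v b =
        b * v b * (∫ x in a..b, u x) + (∫ x in a..b, x * v x) * u b := by
    intro a b
    have h1 := (right hu' a b).mul (right hv a b)
    have h2 := (right hv' a b).mul (right hu a b)
    refine h1.unique (h2.congr_of_eventuallyEq (Filter.Eventually.of_forall fun t => ?_))
    exact key a t
  have second : b * u b * -v a + -(a * u a) * v b = b * v b * -u a + -(a * v a) * u b := by
    have h1 := ((left hv a b).const_mul (b * u b)).add ((left hu' a b).mul_const (v b))
    have h2 := ((left hu a b).const_mul (b * v b)).add ((left hv' a b).mul_const (u b))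
    refine h1.unique (h2.congr_of_eventuallyEq (Filter.Eventually.of_forall fun t => ?_))
    exact first t b
  rcases eq_or_ne a b with rfl | hab
  · rfl
  · refine mul_left_cancel₀ (sub_ne_zero.2 hab) ?_
    linarith

theorem condCov_eq_sub {Ω : Type*} [MeasurableSpace Ω] (P : Measure Ω) [IsFiniteMeasure P]
    (A : Set Ω) (U V : Ω → ℝ) :
    condCov P A U V = (P.real A)⁻¹ * (∫ ω in A, U ω * V ω ∂P) -
      ((P.real A)⁻¹ * ∫ ω in A, U ω ∂P) * ((P.real A)⁻¹ * ∫ ω in A, V ω ∂P) := by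
  simp only [condCov, ProbabilityTheory.cond, integral_smul_measure, ENNReal.toReal_inv,
    smul_eq_mul, measureReal_def]

theorem condCov_eq_zero_iff {Ω : Type*} [MeasurableSpace Ω] {P : Measure Ω} [IsFiniteMeasure P]
    {A : Set Ω} {U V : Ω → ℝ} (hA : P.real A ≠ 0) :
    condCov P A U V = 0 ↔
      (∫ ω in A, U ω * V ω ∂P) * P.real A = (∫ ω in A, U ω ∂P) * ∫ ω in A, V ω ∂P := by
  rw [condCov_eq_sub, sub_eq_zero]
  field_simp

theorem ProbabilityTheory.IndepFun.condCov_inter_preimage_eq_zero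
    {Ω : Type*} [MeasurableSpace Ω] {P : Measure Ω} [IsFiniteMeasure P] {U V : Ω → ℝ}
    (h : IndepFun U V P) (hU : Measurable U) (hV : Measurable V) {s t : Set ℝ}
    (hs : MeasurableSet s) (ht : MeasurableSet t) :
    condCov P (U ⁻¹' s ∩ V ⁻¹' t) U V = 0 := by
  rcases eq_or_ne (P.real (U ⁻¹' s ∩ V ⁻¹' t)) 0 with hA | hA
  · simp [condCov_eq_sub, hA]
  rw [condCov_eq_zero_iff hA]
  have prod : ∀ {φ ψ : ℝ → ℝ}, Measurable φ → Measurable ψ →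
      ∫ ω in U ⁻¹' s ∩ V ⁻¹' t, φ (U ω) * ψ (V ω) ∂P =
        (∫ ω, s.indicator φ (U ω) ∂P) * ∫ ω, t.indicator ψ (V ω) ∂P := by
    intro φ ψ hφ hψ
    rw [← h.integral_fun_comp_mul_comp hU.aemeasurable hV.aemeasurable
      (hφ.indicator hs).aestronglyMeasurable (hψ.indicator ht).aestronglyMeasurable,
      ← integral_indicator ((hU hs).inter (hV ht))]
    congr 1 with ω
    by_cases h1 : U ω ∈ s <;> by_cases h2 : V ω ∈ t <;> simp [indicator, h1, h2]
  have h11 := prod (φ := fun x => x) (ψ := fun x => x) measurable_id measurable_id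
  have h10 := prod (φ := fun x => x) (ψ := fun _ => 1) measurable_id measurable_const
  have h01 := prod (φ := fun _ => 1) (ψ := fun x => x) measurable_const measurable_id
  have h00 := prod (φ := fun _ => 1) (ψ := fun _ => 1) measurable_const measurable_const
  simp only [mul_one, one_mul, integral_const, smul_eq_mul, measureReal_restrict_apply_univ]
    at h11 h10 h01 h00
  rw [h11, h10, h01, h00]
  ring

theorem strictMono_cdfOf {Ω : Type*} [MeasurableSpace Ω] {P : Measure Ω} [IsFiniteMeasure P]
    {U : Ω → ℝ} (hU : Measurable U) (hpos : ∀ a b : ℝ, a < b → P (U ⁻¹' Ioo a b) ≠ 0) :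
    StrictMono (cdfOf P U) := by
  intro a b hab
  refine (ENNReal.toReal_lt_toReal (measure_ne_top _ _) (measure_ne_top _ _)).2 ?_
  have hdisj : Disjoint {ω | U ω ≤ a} (U ⁻¹' Ioo a b) :=
    Set.disjoint_left.2 fun ω h1 h2 => not_lt.2 h1 h2.1
  calc P {ω | U ω ≤ a} < P {ω | U ω ≤ a} + P (U ⁻¹' Ioo a b) :=
        ENNReal.lt_add_right (measure_ne_top _ _) (hpos a b hab)
    _ = P ({ω | U ω ≤ a} ∪ U ⁻¹' Ioo a b) := (measure_union hdisj (hU measurableSet_Ioo)).symm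
    _ ≤ P {ω | U ω ≤ b} := measure_mono <| by
        rintro ω (h | h)
        · exact le_trans h hab.le
        · exact h.2.le

theorem cdfOf_mem_Ioo {Ω : Type*} [MeasurableSpace Ω] {P : Measure Ω} [IsProbabilityMeasure P]
    {U : Ω → ℝ} (hmono : StrictMono (cdfOf P U)) (a : ℝ) : cdfOf P U a ∈ Ioo (0 : ℝ) 1 :=
  ⟨lt_of_le_of_lt ENNReal.toReal_nonneg (hmono (sub_one_lt a)),
    lt_of_lt_of_le (hmono (lt_add_one a)) measureReal_le_one⟩

theorem quantileSet_cdfOf {Ω : Type*} [MeasurableSpace Ω] {P : Measure Ω} {U V : Ω → ℝ}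
    (hU : StrictMono (cdfOf P U)) (hV : StrictMono (cdfOf P V)) (a b c d : ℝ) :
    quantileSet P U V (cdfOf P U a) (cdfOf P U b) (cdfOf P V c) (cdfOf P V d) =
      U ⁻¹' Icc a b ∩ V ⁻¹' Icc c d := by
  simp only [quantileSet, quantileOf, Function.leftInverse_invFun hU.injective _,
    Function.leftInverse_invFun hV.injective _]
  rfl

theorem ProbabilityTheory.IndepFun.condCov_quantileSet_eq_zero
    {Ω : Type*} [MeasurableSpace Ω] {P : Measure Ω} [IsFiniteMeasure P] {U V : Ω → ℝ}
    (h : IndepFun U V P) (hU : Measurable U) (hV : Measurable V) (p₁ q₁ p₂ q₂ : ℝ) :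
    condCov P (quantileSet P U V p₁ q₁ p₂ q₂) U V = 0 := by
  have hset : quantileSet P U V p₁ q₁ p₂ q₂ =
      U ⁻¹' Icc (quantileOf P U p₁) (quantileOf P U q₁) ∩
        V ⁻¹' Icc (quantileOf P V p₂) (quantileOf P V q₂) := rfl
  rw [hset]
  exact h.condCov_inter_preimage_eq_zero hU hV measurableSet_Icc measurableSet_Icc

theorem preimage_ne_zero_of_map_eq_withDensity {Ω : Type*} [MeasurableSpace Ω] {P : Measure Ω}
    {Z : Ω → ℝ × ℝ} (hZ : Measurable Z) {f : ℝ × ℝ → ℝ} (hf : Continuous f) (hpos : ∀ p, 0 < f p)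
    (hmap : Measure.map Z P =
      (volume : Measure (ℝ × ℝ)).withDensity (fun p => ENNReal.ofReal (f p)))
    {s : Set (ℝ × ℝ)} (hs : IsOpen s) (hne : s.Nonempty) : P (Z ⁻¹' s) ≠ 0 := by
  rw [← Measure.map_apply hZ hs.measurableSet, hmap]
  intro h
  refine (hs.measure_pos volume hne).ne' (withDensity_absolutelyContinuous' ?_ ?_ h)
  · exact hf.measurable.ennreal_ofReal.aemeasurable
  · exact Filter.Eventually.of_forall fun p => (ENNReal.ofReal_pos.2 (hpos p)).ne'

theorem setIntegral_rectangle_eq_intervalIntegral {Ω : Type*} [MeasurableSpace Ω] {P : Measure Ω}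
    {U V : Ω → ℝ} (hU : Measurable U) (hV : Measurable V)
    {f : ℝ × ℝ → ℝ} (hf : Continuous f) (hpos : ∀ p, 0 < f p)
    (hmap : Measure.map (fun ω => (U ω, V ω)) P =
      (volume : Measure (ℝ × ℝ)).withDensity (fun p => ENNReal.ofReal (f p)))
    {φ : ℝ × ℝ → ℝ} (hφ : Continuous φ) {a b c d : ℝ} (hab : a ≤ b) (hcd : c ≤ d) :
    ∫ ω in U ⁻¹' Icc a b ∩ V ⁻¹' Icc c d, φ (U ω, V ω) ∂P =
      ∫ x in a..b, ∫ y in c..d, f (x, y) * φ (x, y) := by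
  have hR : MeasurableSet (Icc a b ×ˢ Icc c d) := measurableSet_Icc.prod measurableSet_Icc
  have h1 := setIntegral_map (μ := P) hR hφ.aestronglyMeasurable (hU.prodMk hV).aemeasurable
  have h2 : (fun ω => (U ω, V ω)) ⁻¹' (Icc a b ×ˢ Icc c d) = U ⁻¹' Icc a b ∩ V ⁻¹' Icc c d := rfl
  rw [h2] at h1
  rw [← h1, hmap, setIntegral_withDensity_eq_setIntegral_toReal_smul
    hf.measurable.ennreal_ofReal (by simp) _ hR, Measure.volume_eq_prod]
  simp only [ENNReal.toReal_ofReal (hpos _).le, smul_eq_mul]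
  rw [setIntegral_prod]
  · rw [intervalIntegral.integral_of_le hab, integral_Icc_eq_integral_Ioc]
    simp only [intervalIntegral.integral_of_le hcd, integral_Icc_eq_integral_Ioc]
  · exact (hf.mul hφ).continuousOn.integrableOn_compact (isCompact_Icc.prod isCompact_Icc)

/-- A continuous density on the plane whose conditional covariances vanish on all rectangles
satisfies the cross-ratio identity characterising product densities. -/
theorem density_mul_eq_mul_of_condCov_eq_zero {Ω : Type*} [MeasurableSpace Ω] {P : Measure Ω}
    [IsFiniteMeasure P] {U V : Ω → ℝ} (hU : Measurable U) (hV : Measurable V)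
    {f : ℝ × ℝ → ℝ} (hf : Continuous f) (hpos : ∀ p, 0 < f p)
    (hmap : Measure.map (fun ω => (U ω, V ω)) P =
      (volume : Measure (ℝ × ℝ)).withDensity (fun p => ENNReal.ofReal (f p)))
    (hcov : ∀ a b c d : ℝ, a < b → c < d → condCov P (U ⁻¹' Icc a b ∩ V ⁻¹' Icc c d) U V = 0)
    (a b c d : ℝ) : f (a, c) * f (b, d) = f (a, d) * f (b, c) := by
  refine mul_eq_mul_of_forall_intervalIntegral_moment_eq (u := fun y => f (a, y))
    (v := fun y => f (b, y)) (by fun_prop) (by fun_prop) (fun c d hcd => ?_) c d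
  refine mul_eq_mul_of_forall_intervalIntegral_moment_eq (u := fun x => ∫ y in c..d, y * f (x, y))
    (v := fun x => ∫ y in c..d, f (x, y)) (by fun_prop) (by fun_prop) (fun a b hab => ?_) a b
  have hA : P.real (U ⁻¹' Icc a b ∩ V ⁻¹' Icc c d) ≠ 0 := by
    refine ENNReal.toReal_ne_zero.2 ⟨fun h0 => ?_, measure_ne_top _ _⟩
    refine preimage_ne_zero_of_map_eq_withDensity (hU.prodMk hV) hf hpos hmap
      (isOpen_Ioo.prod isOpen_Ioo) ((nonempty_Ioo.2 hab).prod (nonempty_Ioo.2 hcd))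
      (measure_mono_null ?_ h0)
    exact fun ω h => ⟨Ioo_subset_Icc_self h.1, Ioo_subset_Icc_self h.2⟩
  have h := (condCov_eq_zero_iff hA).1 (hcov a b c d hab hcd)
  have int : ∀ {φ : ℝ × ℝ → ℝ}, Continuous φ → _ := fun hφ =>
    setIntegral_rectangle_eq_intervalIntegral hU hV hf hpos hmap hφ hab.le hcd.le
  have h11 := int (φ := fun p => p.1 * p.2) (by fun_prop)
  have h10 := int (φ := fun p => p.1) (by fun_prop)
  have h01 := int (φ := fun p => p.2) (by fun_prop)
  have h00 := int (φ := fun _ => 1) (by fun_prop)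
  simp only [mul_one, integral_const, smul_eq_mul, measureReal_restrict_apply_univ]
    at h11 h10 h01 h00
  rw [h11, h10, h01, h00] at h
  have e11 : ∀ x, ∫ y in c..d, f (x, y) * (x * y) = x * ∫ y in c..d, y * f (x, y) := fun x => by
    rw [← intervalIntegral.integral_const_mul]
    exact intervalIntegral.integral_congr fun y _ => by ring
  have e10 : ∀ x, ∫ y in c..d, f (x, y) * x = x * ∫ y in c..d, f (x, y) := fun x => by
    rw [← intervalIntegral.integral_const_mul]
    exact intervalIntegral.integral_congr fun y _ => by ring
  have e01 : ∀ x, ∫ y in c..d, f (x, y) * y = ∫ y in c..d, y * f (x, y) := fun x =>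
    intervalIntegral.integral_congr fun y _ => by ring
  simpa only [e11, e10, e01] using h

theorem indepFun_of_density_mul_eq_mul {Ω : Type*} [MeasurableSpace Ω] {P : Measure Ω}
    [IsProbabilityMeasure P] {U V : Ω → ℝ} (hU : Measurable U) (hV : Measurable V)
    {f : ℝ × ℝ → ℝ} (hf : Measurable f) (hpos : ∀ p, 0 < f p)
    (hmap : Measure.map (fun ω => (U ω, V ω)) P =
      (volume : Measure (ℝ × ℝ)).withDensity (fun p => ENNReal.ofReal (f p)))
    (hmul : ∀ a b c d : ℝ, f (a, c) * f (b, d) = f (a, d) * f (b, c)) :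
    IndepFun U V P := by
  set ν₁ : Measure ℝ := volume.withDensity fun x => ENNReal.ofReal (f (x, 0))
  set ν₂ : Measure ℝ := volume.withDensity fun y => ENNReal.ofReal (f (0, y) / f (0, 0))
  have hprod : Measure.map (fun ω => (U ω, V ω)) P = ν₁.prod ν₂ := by
    rw [hmap, prod_withDensity (by fun_prop) (by fun_prop), Measure.volume_eq_prod]
    congr 1 with p
    rw [← ENNReal.ofReal_mul (hpos _).le, ← mul_div_assoc, ← hmul p.1 0 p.2 0,
      mul_div_cancel_right₀ _ (hpos _).ne']
  have hrect : ∀ s t : Set ℝ, MeasurableSet s → MeasurableSet t →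
      P (U ⁻¹' s ∩ V ⁻¹' t) = ν₁ s * ν₂ t := by
    intro s t hs ht
    rw [← Measure.prod_prod, ← hprod, Measure.map_apply (hU.prodMk hV) (hs.prod ht)]
    rfl
  have h1 := hrect univ univ .univ .univ
  simp only [preimage_univ, inter_univ, measure_univ] at h1
  refine indepFun_iff_measure_inter_preimage_eq_mul.2 fun s t hs ht => ?_
  have hs' := hrect s univ hs .univ
  have ht' := hrect univ t .univ ht
  simp only [preimage_univ, inter_univ, univ_inter] at hs' ht'
  rw [hrect s t hs ht, hs', ht']
  calc ν₁ s * ν₂ t = ν₁ s * ν₂ t * (ν₁ univ * ν₂ univ) := by rw [← h1, mul_one]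
    _ = _ := by ring

theorem indepFun_of_condCov_quantileSet_eq_zero {Ω : Type*} [MeasurableSpace Ω] {P : Measure Ω}
    [IsProbabilityMeasure P] {U V : Ω → ℝ} (hU : Measurable U) (hV : Measurable V)
    {f : ℝ × ℝ → ℝ} (hf : Continuous f) (hpos : ∀ p, 0 < f p)
    (hmap : Measure.map (fun ω => (U ω, V ω)) P =
      (volume : Measure (ℝ × ℝ)).withDensity (fun p => ENNReal.ofReal (f p)))
    (hcov : ∀ p₁ q₁ p₂ q₂ : ℝ, 0 < p₁ → p₁ < q₁ → q₁ < 1 → 0 < p₂ → p₂ < q₂ → q₂ < 1 →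
      condCov P (quantileSet P U V p₁ q₁ p₂ q₂) U V = 0) :
    IndepFun U V P := by
  have hopen := fun s => preimage_ne_zero_of_map_eq_withDensity (s := s)
    (hU.prodMk hV) hf hpos hmap
  have hFU : StrictMono (cdfOf P U) := strictMono_cdfOf hU fun a b hab => by
    simpa [mk_preimage_prod] using hopen (Ioo a b ×ˢ univ) (isOpen_Ioo.prod isOpen_univ)
      ((nonempty_Ioo.2 hab).prod univ_nonempty)
  have hFV : StrictMono (cdfOf P V) := strictMono_cdfOf hV fun a b hab => by
    simpa [mk_preimage_prod] using hopen (univ ×ˢ Ioo a b) (isOpen_univ.prod isOpen_Ioo)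
      (univ_nonempty.prod (nonempty_Ioo.2 hab))
  refine indepFun_of_density_mul_eq_mul hU hV hf.measurable hpos hmap
    (density_mul_eq_mul_of_condCov_eq_zero hU hV hf hpos hmap fun a b c d hab hcd => ?_)
  rw [← quantileSet_cdfOf hFU hFV]
  exact hcov _ _ _ _ (cdfOf_mem_Ioo hFU a).1 (hFU hab) (cdfOf_mem_Ioo hFU b).2
    (cdfOf_mem_Ioo hFV c).1 (hFV hcd) (cdfOf_mem_Ioo hFV d).2

theorem apply_eq_sum_mul_apply_single {ι : Type*} [Fintype ι] [DecidableEq ι]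
    (L : StrongDual ℝ (ι → ℝ)) (x : ι → ℝ) : L x = ∑ i, x i * L (Pi.single i 1) := by
  conv_lhs => rw [← Finset.univ_sum_single x, map_sum]
  refine Finset.sum_congr rfl fun i _ => ?_
  rw [← smul_eq_mul, ← map_smul, ← Pi.single_smul, smul_eq_mul, mul_one]

theorem indepFun_of_forall_linear_combinations {Ω : Type*} [MeasurableSpace Ω] {P : Measure Ω}
    [IsProbabilityMeasure P] {ι κ : Type*} [Fintype ι] [Fintype κ]
    {X : Ω → ι → ℝ} {Y : Ω → κ → ℝ} (hX : Measurable X) (hY : Measurable Y)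
    (h : ∀ (α : ι → ℝ) (β : κ → ℝ), α ≠ 0 → β ≠ 0 →
      IndepFun (fun ω => ∑ i, X ω i * α i) (fun ω => ∑ j, Y ω j * β j) P) :
    IndepFun X Y P := by
  classical
  rw [indepFun_iff_charFunDual_prod hX.aemeasurable hY.aemeasurable]
  intro L
  set L₁ := L.comp (.inl ℝ (ι → ℝ) (κ → ℝ))
  set L₂ := L.comp (.inr ℝ (ι → ℝ) (κ → ℝ))
  have hind : IndepFun (fun ω => L₁ (X ω)) (fun ω => L₂ (Y ω)) P := by
    rw [funext fun ω => apply_eq_sum_mul_apply_single L₁ (X ω),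
      funext fun ω => apply_eq_sum_mul_apply_single L₂ (Y ω)]
    by_cases hα : (fun i => L₁ (Pi.single i 1)) = 0
    · simp only [funext_iff, Pi.zero_apply] at hα
      simp only [hα, mul_zero, Finset.sum_const_zero]
      exact indepFun_const_left _ _
    by_cases hβ : (fun j => L₂ (Pi.single j 1)) = 0
    · simp only [funext_iff, Pi.zero_apply] at hβ
      simp only [hβ, mul_zero, Finset.sum_const_zero]
      exact indepFun_const_right _ _
    exact h _ _ hα hβ
  have hL : ∀ x y, L (x, y) = L₁ x + L₂ y := fun x y => by
    simp [L₁, L₂, ← map_add]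
  simp only [charFunDual_apply]
  rw [integral_map (by fun_prop) (by fun_prop), integral_map (by fun_prop) (by fun_prop),
    integral_map (by fun_prop) (by fun_prop)]
  simp only [hL, Complex.ofReal_add, add_mul, Complex.exp_add]
  exact hind.integral_fun_comp_mul_comp (f := fun x : ℝ => Complex.exp (x * Complex.I))
    (g := fun x : ℝ => Complex.exp (x * Complex.I)) (by fun_prop) (by fun_prop) (by fun_prop)
    (by fun_prop)

/-- Multivariate version via linear combinations: random vectors `X` (in `ℝⁿ`) and `Y` (in `ℝᵐ`)
are independent if and only if for all nonzero `α`, `β`, the linear combinations `⟨X,α⟩` and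
`⟨Y,β⟩` are conditionally uncorrelated on every quantile set. -/
theorem indepFun_iff_condCov_eq_zero_for_linear_combinations
    {Ω : Type*} [MeasurableSpace Ω] (P : Measure Ω) [IsProbabilityMeasure P]
    {n m : ℕ} (X : Ω → (Fin n → ℝ)) (Y : Ω → (Fin m → ℝ))
    (hX : Measurable X) (hY : Measurable Y)
    (hdens : ∀ (α : Fin n → ℝ) (β : Fin m → ℝ), α ≠ 0 → β ≠ 0 →
      ∃ f : ℝ × ℝ → ℝ, Continuous f ∧ (∀ p, 0 < f p) ∧
        Measure.map (fun ω => (∑ i, X ω i * α i, ∑ j, Y ω j * β j)) P =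
          (volume : Measure (ℝ × ℝ)).withDensity (fun p => ENNReal.ofReal (f p))) :
    IndepFun X Y P ↔
      ∀ (α : Fin n → ℝ) (β : Fin m → ℝ), α ≠ 0 → β ≠ 0 →
        ∀ p₁ q₁ p₂ q₂ : ℝ, 0 < p₁ → p₁ < q₁ → q₁ < 1 → 0 < p₂ → p₂ < q₂ → q₂ < 1 →
          condCov P
            (quantileSet P (fun ω => ∑ i, X ω i * α i) (fun ω => ∑ j, Y ω j * β j) p₁ q₁ p₂ q₂)
            (fun ω => ∑ i, X ω i * α i) (fun ω => ∑ j, Y ω j * β j) = 0 := by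
  have hXα : ∀ α : Fin n → ℝ, Measurable fun ω => ∑ i, X ω i * α i := fun α => by fun_prop
  have hYβ : ∀ β : Fin m → ℝ, Measurable fun ω => ∑ j, Y ω j * β j := fun β => by fun_prop
  constructor
  · intro h α β _ _ p₁ q₁ p₂ q₂ _ _ _ _ _ _
    have hind : IndepFun (fun ω => ∑ i, X ω i * α i) (fun ω => ∑ j, Y ω j * β j) P :=
      h.comp (φ := fun x : Fin n → ℝ => ∑ i, x i * α i)
        (ψ := fun y : Fin m → ℝ => ∑ j, y j * β j) (by fun_prop) (by fun_prop)
    exact hind.condCov_quantileSet_eq_zero (hXα α) (hYβ β) p₁ q₁ p₂ q₂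
  · intro h
    refine indepFun_of_forall_linear_combinations hX hY fun α β hα hβ => ?_
    obtain ⟨f, hf, hpos, hmap⟩ := hdens α β hα hβ
    exact indepFun_of_condCov_quantileSet_eq_zero (hXα α) (hYβ β) hf hpos hmap (h α β hα hβ)
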